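/- The position R0 (with Alfred to move) on the official 19-by-15 Phutball pitch is drawn: both Alfred and Betty have drawing strategies from R0. -/

import Mathlib

/-!
Formalization of Philosophers' Phutball on an `m × n` board (`m` rows, `n` columns).
Points are pairs `(column, row)` of integers, with columns `1, …, n` (a, b, c, …)
and rows `1, …, m` (bottom to top).  Player `true` is Alfred (first player, aims
for the top row `m`); player `false` is Betty (aims for the bottom row `1`).
-/

/-- A player: `true` is Alfred, `false` is Betty. -/
abbrev Player := Bool

/-- A Phutball position: the ball's point `(column, row)`, the finite set of
chaps, and the player whose turn it is. -/
structure PState where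
  ball : ℤ × ℤ
  chaps : Finset (ℤ × ℤ)
  turn : Player
deriving DecidableEq

/-- The eight horizontal, vertical and diagonal directions. -/
def dirs : Finset (ℤ × ℤ) :=
  {(1, 0), (1, 1), (0, 1), (-1, 1), (-1, 0), (-1, -1), (0, -1), (1, -1)}

/-- The point reached from `b` after `i` steps in direction `d`. -/
def ray (b d : ℤ × ℤ) (i : ℤ) : ℤ × ℤ := (b.1 + i * d.1, b.2 + i * d.2)

/-- A point is on the `m × n` board. -/
def OnBoard (m n : ℤ) (p : ℤ × ℤ) : Prop :=
  1 ≤ p.1 ∧ p.1 ≤ n ∧ 1 ≤ p.2 ∧ p.2 ≤ m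

/-- A single hop on a board with `n` columns: the ball at `b` moves in one of the
eight directions `d` over a contiguous nonempty line of `k` chaps, landing on the
first point beyond them that carries no chap; the jumped-over chaps are removed.
The landing point must not lie onto or past the sidelines (outside columns
`1, …, n`), but it may lie past the top or bottom row. -/
def Hop (n : ℤ) (b : ℤ × ℤ) (c : Finset (ℤ × ℤ)) (b' : ℤ × ℤ) (c' : Finset (ℤ × ℤ)) : Prop :=
  ∃ d ∈ dirs, ∃ k : ℕ, 1 ≤ k ∧
    (∀ i : ℕ, 1 ≤ i → i ≤ k → ray b d i ∈ c) ∧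
    ray b d (k + 1) ∉ c ∧
    1 ≤ (ray b d (k + 1)).1 ∧ (ray b d (k + 1)).1 ≤ n ∧
    b' = ray b d (k + 1) ∧
    c' = c \ Finset.image (fun i : ℕ => ray b d i) (Finset.Icc 1 k)

/-- A jump is a nonempty sequence of hops (the player may stop after any hop,
and the removed chaps cannot be re-used by later hops of the same jump).  The
jump can continue after a hop only if the ball has not been carried past the top
or bottom row (which would end the game immediately). -/
inductive Jump (m n : ℤ) : ℤ × ℤ → Finset (ℤ × ℤ) → ℤ × ℤ → Finset (ℤ × ℤ) → Prop
  | single {b c b' c'} : Hop n b c b' c' → Jump m n b c b' c'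
  | cons {b c b₁ c₁ b' c'} : Hop n b c b₁ c₁ → 1 ≤ b₁.2 → b₁.2 ≤ m →
      Jump m n b₁ c₁ b' c' → Jump m n b c b' c'

/-- The winner, if any, of a position (evaluated between turns): Alfred wins if
the ball rests on the top row `m` or has been carried past it; Betty wins if the
ball rests on the bottom row `1` or has been carried past it. -/
def winner (m : ℤ) (s : PState) : Option Player :=
  if m ≤ s.ball.2 then some true else if s.ball.2 ≤ 1 then some false else none

/-- A single legal move on the `m × n` board: the player to move either places a
chap on a vacant on-board point, or moves the ball by a jump; the turn passes to
the other player. -/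
def MoveRel (m n : ℤ) (s t : PState) : Prop :=
  t.turn = !s.turn ∧
    ((∃ p, OnBoard m n p ∧ p ∉ s.chaps ∧ p ≠ s.ball ∧
        t.ball = s.ball ∧ t.chaps = insert p s.chaps) ∨
      Jump m n s.ball s.chaps t.ball t.chaps)

/-- An infinite record of play: while the game is not over and a legal move
exists, a legal move is made; otherwise the position is frozen forever. -/
def IsPlay (m n : ℤ) (f : ℕ → PState) : Prop :=
  ∀ k,
    (winner m (f k) = none ∧ (∃ t, MoveRel m n (f k) t) ∧ MoveRel m n (f k) (f (k + 1))) ∨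
    ((winner m (f k) ≠ none ∨ ¬ ∃ t, MoveRel m n (f k) t) ∧ f (k + 1) = f k)

/-- A strategy for player `p` that always proposes a legal move whenever the game
is not over, it is `p`'s turn, and some legal move exists. -/
def LegalStrategy (m n : ℤ) (p : Player) (σ : PState → PState) : Prop :=
  ∀ s, s.turn = p → winner m s = none → (∃ t, MoveRel m n s t) → MoveRel m n s (σ s)

/-- The play `f` follows the strategy `σ` of player `p`. -/
def Follows (m n : ℤ) (p : Player) (σ : PState → PState) (f : ℕ → PState) : Prop :=
  ∀ k, (f k).turn = p → winner m (f k) = none → (∃ t, MoveRel m n (f k) t) →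
    f (k + 1) = σ (f k)

/-- Player `p` has a winning strategy from `s₀` on the `m × n` board: a legal
strategy guaranteeing that, against every play of the opponent, `p` wins after
finitely many moves. -/
def WinsFrom (m n : ℤ) (p : Player) (s₀ : PState) : Prop :=
  ∃ σ, LegalStrategy m n p σ ∧
    ∀ f, IsPlay m n f → f 0 = s₀ → Follows m n p σ f → ∃ k, winner m (f k) = some p

/-- Player `p` has a drawing strategy from `s₀` on the `m × n` board: a legal
strategy guaranteeing that the opponent never wins (play may continue forever). -/
def DrawsFrom (m n : ℤ) (p : Player) (s₀ : PState) : Prop :=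
  ∃ σ, LegalStrategy m n p σ ∧
    ∀ f, IsPlay m n f → f 0 = s₀ → Follows m n p σ f → ∀ k, winner m (f k) ≠ some (!p)

/-- A position is drawn if both players have drawing strategies from it. -/
def Drawn (m n : ℤ) (s : PState) : Prop :=
  DrawsFrom m n true s ∧ DrawsFrom m n false s

/-- The chaps of the position `R0` on the official 19 × 15 board:
c1, c2, c5, c7, c9–c19, d6, e4, e11–e19, f1, f2, f9, g6, g13–g19,
h1, h2, h3, h4, h11, i8, i15–i19, j1–j6, j13, k11, l1–l8, l10, l12, l15–l19,
n17, n18, n19, and o1–o19. -/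
def R0chaps : Finset (ℤ × ℤ) :=
  {(3, 1), (3, 2), (3, 5), (3, 7), (3, 9), (3, 10), (3, 11), (3, 12), (3, 13), (3, 14), (3, 15), (3, 16), (3, 17), (3, 18), (3, 19), (4, 6), (5, 4), (5, 11), (5, 12), (5, 13), (5, 14), (5, 15), (5, 16), (5, 17), (5, 18), (5, 19), (6, 1), (6, 2), (6, 9), (7, 6), (7, 13), (7, 14), (7, 15), (7, 16), (7, 17), (7, 18), (7, 19), (8, 1), (8, 2), (8, 3), (8, 4), (8, 11), (9, 8), (9, 15), (9, 16), (9, 17), (9, 18), (9, 19), (10, 1), (10, 2), (10, 3), (10, 4), (10, 5), (10, 6), (10, 13), (11, 11), (12, 1), (12, 2), (12, 3), (12, 4), (12, 5), (12, 6), (12, 7), (12, 8), (12, 10), (12, 12), (12, 15), (12, 16), (12, 17), (12, 18), (12, 19), (14, 17), (14, 18), (14, 19), (15, 1), (15, 2), (15, 3), (15, 4), (15, 5), (15, 6), (15, 7), (15, 8), (15, 9), (15, 10), (15, 11), (15, 12), (15, 13), (15, 14), (15, 15), (15, 16), (15, 17), (15, 18), (15, 19)}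

/-- The position `R0`: ball at a2 = (1, 2), the chaps above, Alfred to move. -/
def R0 : PState := ⟨(1, 2), R0chaps, true⟩

/-! ### Forced play and drawing strategies -/

/-- Player `P` can force play from `s` either to a win or into the set `G`. -/
inductive Forced (P : Player) (G : PState → Prop) : PState → Prop
  | base {s} : G s → Forced P G s
  | won {s} : winner 19 s = some P → Forced P G s
  | mine {s t} : winner 19 s = none → s.turn = P → MoveRel 19 15 s t → Forced P G t →
      Forced P G s
  | theirs {s} : winner 19 s = none → s.turn = (!P) →
      (∀ t, MoveRel 19 15 s t → Forced P G t) → Forced P G s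

theorem Forced.progress {P : Player} {G : PState → Prop}
    (hG : ∀ s, G s → winner 19 s = none ∧ s.turn = P ∧
      ∃ t, MoveRel 19 15 s t ∧ Forced P G t) {s : PState} (h : Forced P G s) :
    winner 19 s = some P ∨
      winner 19 s = none ∧ s.turn = P ∧ (∃ t, MoveRel 19 15 s t ∧ Forced P G t) ∨
      winner 19 s = none ∧ s.turn = (!P) ∧ ∀ t, MoveRel 19 15 s t → Forced P G t := by
  cases h with
  | base h => exact .inr (.inl (hG s h))
  | won h => exact .inl h
  | mine h₁ h₂ h₃ h₄ => exact .inr (.inl ⟨h₁, h₂, _, h₃, h₄⟩)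
  | theirs h₁ h₂ h₃ => exact .inr (.inr ⟨h₁, h₂, h₃⟩)

/-- If `P` can always leave `G` by a move after which returning to `G` or winning is forced,
then `P` draws from every position from which `G` or a win is forced. -/
theorem Forced.drawsFrom {P : Player} {G : PState → Prop}
    (hG : ∀ s, G s → winner 19 s = none ∧ s.turn = P ∧
      ∃ t, MoveRel 19 15 s t ∧ Forced P G t) {s₀ : PState} (h₀ : Forced P G s₀) :
    DrawsFrom 19 15 P s₀ := by
  classical
  let σ : PState → PState := fun s =>
    if h : ∃ t, MoveRel 19 15 s t ∧ Forced P G t then h.choose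
    else if h' : ∃ t, MoveRel 19 15 s t then h'.choose else s
  have σ_forced : ∀ s, (∃ t, MoveRel 19 15 s t ∧ Forced P G t) →
      MoveRel 19 15 s (σ s) ∧ Forced P G (σ s) := by
    intro s h
    simp only [σ, dif_pos h]
    exact h.choose_spec
  refine ⟨σ, fun s _ _ hm => ?_, fun f hf hf₀ hσ => ?_⟩
  · by_cases h : ∃ t, MoveRel 19 15 s t ∧ Forced P G t
    · exact (σ_forced s h).1
    · simp only [σ, dif_neg h, dif_pos hm]
      exact hm.choose_spec
  · have inv : ∀ k, Forced P G (f k) := by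
      intro k
      induction k with
      | zero => exact hf₀ ▸ h₀
      | succ k ih =>
        rcases hf k with ⟨hw, hm, hmove⟩ | ⟨-, heq⟩
        · rcases ih.progress hG with h | ⟨-, ht, hex⟩ | ⟨-, -, hall⟩
          · simp [hw] at h
          · rw [hσ k ht hw hm]
            exact (σ_forced _ hex).2
          · exact hall _ hmove
        · exact heq ▸ ih
    intro k
    rcases (inv k).progress hG with h | ⟨h, -⟩ | ⟨h, -⟩ <;> simp [h]

/-! ### Bitboards

The point in column `x` and row `y` is encoded as the number `16 * y + x`, so that the numbers
divisible by `16` act as sidelines, and a set of points as the number with these binary digits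
set. -/

/-- The eight compass directions. -/
inductive Dir
  | e | ne | n | nw | w | sw | s | se
deriving DecidableEq

namespace Dir

/-- The displacement of one step, as an increment of codes shifted by `17`. -/
def off : Dir → ℕ
  | e => 18 | ne => 34 | n => 33 | nw => 32 | w => 16 | sw => 0 | s => 1 | se => 2

/-- The displacement of one step. -/
def vec : Dir → ℤ × ℤ
  | e => (1, 0) | ne => (1, 1) | n => (0, 1) | nw => (-1, 1)
  | w => (-1, 0) | sw => (-1, -1) | s => (0, -1) | se => (1, -1)

/-- All directions. -/
def all : List Dir := [e, ne, n, nw, w, sw, s, se]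

theorem mem_all (d : Dir) : d ∈ all := by cases d <;> simp [all]

theorem mem_dirs_iff {v : ℤ × ℤ} : v ∈ dirs ↔ ∃ d : Dir, d.vec = v := by
  constructor
  · intro h
    simp only [dirs, Finset.mem_insert, Finset.mem_singleton] at h
    rcases h with rfl | rfl | rfl | rfl | rfl | rfl | rfl | rfl
    exacts [⟨e, rfl⟩, ⟨ne, rfl⟩, ⟨n, rfl⟩, ⟨nw, rfl⟩, ⟨w, rfl⟩, ⟨sw, rfl⟩, ⟨s, rfl⟩, ⟨se, rfl⟩]
  · rintro ⟨d, rfl⟩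
    cases d <;> simp [dirs, vec]

theorem vec_bounds (d : Dir) :
    -1 ≤ d.vec.1 ∧ d.vec.1 ≤ 1 ∧ -1 ≤ d.vec.2 ∧ d.vec.2 ≤ 1 ∧
      (d.off : ℤ) = 16 * d.vec.2 + d.vec.1 + 17 := by
  cases d <;> simp [vec, off]

end Dir

/-- The bitboard of all points of the board. -/
def full : ℕ :=
  2135954442847957905541700656017630705399765593470983178846561756725739643080926189138701417578496

/-- The code of a point. -/
def code (p : ℤ × ℤ) : ℕ := (16 * p.2 + p.1).toNat

/-- The point with a given code. -/
def pt (i : ℕ) : ℤ × ℤ := ((i % 16 : ℕ), (i / 16 : ℕ))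

set_option exponentiation.threshold 400 in
theorem testBit_full (i : ℕ) :
    full.testBit i = true ↔ 1 ≤ i % 16 ∧ 1 ≤ i / 16 ∧ i / 16 ≤ 19 := by
  have small : ∀ j < 320, full.testBit j = true ↔ 1 ≤ j % 16 ∧ 1 ≤ j / 16 ∧ j / 16 ≤ 19 := by
    decide +kernel
  rcases lt_or_ge i 320 with h | h
  · exact small i h
  · have : full < 2 ^ i := lt_of_lt_of_le (by decide +kernel : full < 2 ^ 320)
      (Nat.pow_le_pow_right (by norm_num) h)
    rw [Nat.testBit_lt_two_pow this]
    simp only [Bool.false_eq_true, false_iff]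
    omega

theorem testBit_full_code {p : ℤ × ℤ} (hp : OnBoard 19 15 p) :
    full.testBit (code p) = true := by
  obtain ⟨h₁, h₂, h₃, h₄⟩ := hp
  rw [testBit_full]
  unfold code
  omega

theorem onBoard_of_testBit_full {p : ℤ × ℤ} (h₀ : 0 ≤ p.1) (h₁ : p.1 ≤ 16) (h₂ : 0 ≤ p.2)
    (h : full.testBit (code p) = true) : OnBoard 19 15 p := by
  rw [testBit_full] at h
  unfold code at h
  refine ⟨?_, ?_, ?_, ?_⟩ <;> omega

theorem pt_code {p : ℤ × ℤ} (h₀ : 0 ≤ p.1) (h₁ : p.1 ≤ 15) (h₂ : 0 ≤ p.2) :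
    pt (code p) = p := by
  ext <;> simp only [pt, code] <;> omega

theorem code_pt (i : ℕ) : code (pt i) = i := by
  simp only [pt, code]; omega

theorem OnBoard.pt_code {p : ℤ × ℤ} (hp : OnBoard 19 15 p) : pt (code p) = p := by
  obtain ⟨h₁, h₂, h₃, h₄⟩ := hp
  exact _root_.pt_code (by omega) (by omega) (by omega)

theorem OnBoard.eq_of_code_eq {p q : ℤ × ℤ} (hp : OnBoard 19 15 p) (hq : OnBoard 19 15 q)
    (h : code p = code q) : p = q := by
  rw [← hp.pt_code, h, hq.pt_code]

/-- The set `c` of points of the board agrees with the bitboard `m` on the zone `z`. -/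
structure Agrees (c : Finset (ℤ × ℤ)) (m z : ℕ) : Prop where
  onBoard : ∀ p ∈ c, OnBoard 19 15 p
  iff : ∀ p, OnBoard 19 15 p → z.testBit (code p) = true →
    (p ∈ c ↔ m.testBit (code p) = true)

theorem Agrees.mono {c : Finset (ℤ × ℤ)} {m z z' : ℕ} (h : Agrees c m z)
    (hz : ∀ i, z'.testBit i = true → z.testBit i = true) : Agrees c m z' :=
  ⟨h.onBoard, fun p hp hz' => h.iff p hp (hz _ hz')⟩

theorem Agrees.left {c : Finset (ℤ × ℤ)} {m z z' : ℕ} (h : Agrees c m (z ||| z')) :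
    Agrees c m z := h.mono fun i hi => by simp [hi]

theorem Agrees.right {c : Finset (ℤ × ℤ)} {m z z' : ℕ} (h : Agrees c m (z ||| z')) :
    Agrees c m z' := h.mono fun i hi => by simp [hi]

theorem Agrees.insert {c : Finset (ℤ × ℤ)} {m z : ℕ} (h : Agrees c m z) {p : ℤ × ℤ}
    (hp : OnBoard 19 15 p) : Agrees (insert p c) (m ||| 2 ^ code p) z := by
  refine ⟨fun q hq => ?_, fun q hq hz => ?_⟩
  · rcases Finset.mem_insert.1 hq with rfl | hq
    exacts [hp, h.onBoard q hq]
  · rw [Finset.mem_insert, h.iff q hq hz, Nat.testBit_or, Nat.testBit_two_pow]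
    by_cases hqp : q = p
    · simp [hqp]
    · have : code p ≠ code q := fun e => hqp (hp.eq_of_code_eq hq e).symm
      simp [hqp, this]

theorem Agrees.insert_of_not_mem {c : Finset (ℤ × ℤ)} {m z : ℕ} (h : Agrees c m z)
    {p : ℤ × ℤ} (hp : OnBoard 19 15 p) (hz : ¬ z.testBit (code p) = true) :
    Agrees (Insert.insert p c) m z := by
  refine ⟨fun q hq => ?_, fun q hq hzq => ?_⟩
  · rcases Finset.mem_insert.1 hq with rfl | hq
    exacts [hp, h.onBoard q hq]
  · have : q ≠ p := by rintro rfl; exact hz hzq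
    rw [Finset.mem_insert, h.iff q hq hzq]
    simp [this]

/-- The set of points of a bitboard. -/
noncomputable def pointsOf (m : ℕ) : Finset (ℤ × ℤ) :=
  (Finset.Icc 1 15 ×ˢ Finset.Icc 1 19).filter fun p => m.testBit (code p) = true

theorem mem_pointsOf {m : ℕ} {p : ℤ × ℤ} :
    p ∈ pointsOf m ↔ OnBoard 19 15 p ∧ m.testBit (code p) = true := by
  simp only [pointsOf, Finset.mem_filter, Finset.mem_product, Finset.mem_Icc, OnBoard]
  tauto

theorem agrees_pointsOf (m z : ℕ) : Agrees (pointsOf m) m z :=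
  ⟨fun _ hp => (mem_pointsOf.1 hp).1, fun p hp _ => by simp [mem_pointsOf, hp]⟩

theorem Agrees.eq_pointsOf {c : Finset (ℤ × ℤ)} {m : ℕ} (h : Agrees c m full) :
    c = pointsOf m := by
  ext p
  rw [mem_pointsOf]
  constructor
  · intro hp
    have hb := h.onBoard p hp
    exact ⟨hb, (h.iff p hb (testBit_full_code hb)).1 hp⟩
  · rintro ⟨hb, hm⟩
    exact (h.iff p hb (testBit_full_code hb)).2 hm

/-! ### Hops on bitboards -/

/-- Follow the chaps of `m` from the code `q` in direction `d`, at most `f` steps. Returns the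
first code without a chap and the chaps passed, added to `r`. -/
def slide (d : Dir) (m : ℕ) : ℕ → ℕ → ℕ → Option (ℕ × ℕ)
  | 0, _, _ => none
  | f + 1, q, r =>
    if m.testBit q then slide d m f (q + d.off - 17) (r ||| 2 ^ q) else some (q, r)

/-- The result of following the chaps in direction `d` from a ball at `b`. -/
def scan (d : Dir) (b m : ℕ) : Option (ℕ × ℕ) :=
  slide d (m &&& full) 20 (b + d.off - 17) 0

/-- A hop in a given direction. -/
def HopIn (d : Dir) (b : ℤ × ℤ) (c : Finset (ℤ × ℤ)) (b' : ℤ × ℤ)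
    (c' : Finset (ℤ × ℤ)) : Prop :=
  ∃ k : ℕ, 1 ≤ k ∧
    (∀ i : ℕ, 1 ≤ i → i ≤ k → ray b d.vec i ∈ c) ∧
    ray b d.vec (k + 1) ∉ c ∧
    1 ≤ (ray b d.vec (k + 1)).1 ∧ (ray b d.vec (k + 1)).1 ≤ 15 ∧
    b' = ray b d.vec (k + 1) ∧
    c' = c \ Finset.image (fun i : ℕ => ray b d.vec i) (Finset.Icc 1 k)

theorem hop_iff {b b' : ℤ × ℤ} {c c' : Finset (ℤ × ℤ)} :
    Hop 15 b c b' c' ↔ ∃ d, HopIn d b c b' c' := by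
  constructor
  · rintro ⟨v, hv, h⟩
    obtain ⟨d, rfl⟩ := Dir.mem_dirs_iff.1 hv
    exact ⟨d, h⟩
  · rintro ⟨d, h⟩
    exact ⟨d.vec, Dir.mem_dirs_iff.2 ⟨d, rfl⟩, h⟩

theorem slide_spec {d : Dir} {c : Finset (ℤ × ℤ)} {m : ℕ} {b : ℤ × ℤ} :
    ∀ (f : ℕ) {q r q' r' : ℕ} {k : ℕ},
      slide d (m &&& full) f q r = some (q', r') →
      Agrees c m (r' ||| 2 ^ q') →
      q = code (ray b d.vec (k + 1)) →
      0 ≤ (ray b d.vec (k + 1)).1 → (ray b d.vec (k + 1)).1 ≤ 16 →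
      0 ≤ (ray b d.vec (k + 1)).2 →
      (∀ i : ℕ, 1 ≤ i → i ≤ k → ray b d.vec i ∈ c) →
      (∀ j, r.testBit j = true ↔ ∃ i : ℕ, 1 ≤ i ∧ i ≤ k ∧ code (ray b d.vec i) = j) →
      ∃ n : ℕ, (∀ i : ℕ, 1 ≤ i → i ≤ n → ray b d.vec i ∈ c) ∧
        (∀ j, r'.testBit j = true ↔ ∃ i : ℕ, 1 ≤ i ∧ i ≤ n ∧ code (ray b d.vec i) = j) ∧
        ray b d.vec (n + 1) ∉ c ∧ q' = code (ray b d.vec (n + 1)) ∧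
        0 ≤ (ray b d.vec (n + 1)).1 ∧ (ray b d.vec (n + 1)).1 ≤ 16 ∧
        0 ≤ (ray b d.vec (n + 1)).2
  | 0, _, _, _, _, _ => by simp [slide]
  | f + 1, q, r, q', r', k => by
    intro hs hA hq hx hx' hy hc hr
    rw [slide] at hs
    split at hs
    next ht =>
      rw [Nat.testBit_and, Bool.and_eq_true] at ht
      obtain ⟨htm, htf⟩ := ht
      rw [hq] at htm htf
      have hb := onBoard_of_testBit_full hx hx' hy htf
      obtain ⟨v₁, v₂, v₃, v₄, v₅⟩ := d.vec_bounds
      obtain ⟨b₁, b₂, b₃, b₄⟩ := hb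
      have e₁ : (ray b d.vec ((k + 1 : ℕ) + 1)).1 = (ray b d.vec (k + 1)).1 + d.vec.1 := by
        simp only [ray]; push_cast; ring
      have e₂ : (ray b d.vec ((k + 1 : ℕ) + 1)).2 = (ray b d.vec (k + 1)).2 + d.vec.2 := by
        simp only [ray]; push_cast; ring
      have hr' : ∀ j, (r ||| 2 ^ q).testBit j = true ↔
          ∃ i : ℕ, 1 ≤ i ∧ i ≤ k + 1 ∧ code (ray b d.vec i) = j := by
        intro j
        rw [Nat.testBit_or, Bool.or_eq_true, hr, Nat.testBit_two_pow, decide_eq_true_eq, hq]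
        constructor
        · rintro (⟨i, h₁, h₂, h₃⟩ | h)
          · exact ⟨i, h₁, by omega, h₃⟩
          · exact ⟨k + 1, by omega, le_rfl, by simpa using h⟩
        · rintro ⟨i, h₁, h₂, h₃⟩
          rcases Nat.lt_or_ge k i with h | h
          · obtain rfl : i = k + 1 := by omega
            right; simpa using h₃
          · exact .inl ⟨i, h₁, h, h₃⟩
      have hmono : r'.testBit (code (ray b d.vec (k + 1))) = true := by
        rw [← hq]
        exact slide_subset f hs q (by simp)
      have hmem : ray b d.vec (k + 1) ∈ c :=
        (hA.iff _ ⟨b₁, b₂, b₃, b₄⟩ (by simp [hmono])).2 htm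
      refine slide_spec f (k := k + 1) hs hA ?_ (by omega) (by omega) (by omega) ?_ hr'
      · rw [hq]
        simp only [code, e₁, e₂]
        omega
      · intro i h₁ h₂
        rcases Nat.lt_or_ge k i with h | h
        · obtain rfl : i = k + 1 := by omega
          simpa using hmem
        · exact hc i h₁ h
    next ht =>
      simp only [Option.some.injEq, Prod.mk.injEq] at hs
      obtain ⟨rfl, rfl⟩ := hs
      refine ⟨k, hc, hr, fun hmem => ht ?_, hq, hx, hx', hy⟩
      have hb := hA.onBoard _ hmem
      rw [Nat.testBit_and, Bool.and_eq_true, hq]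
      exact ⟨(hA.iff _ hb (by simp [hq])).1 hmem, testBit_full_code hb⟩
where
  slide_subset {d : Dir} {m : ℕ} : ∀ (f : ℕ) {q r q' r' : ℕ},
      slide d m f q r = some (q', r') → ∀ j, r.testBit j = true → r'.testBit j = true
    | 0, _, _, _, _ => by simp [slide]
    | f + 1, q, r, q', r' => by
      intro h j hj
      rw [slide] at h
      split at h
      · exact slide_subset f h j (by simp [hj])
      · simp only [Option.some.injEq, Prod.mk.injEq] at h
        exact h.2 ▸ hj

/-- The code `b` is a point of the board. -/
def onCode (b : ℕ) : Bool := full.testBit b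

theorem onBoard_pt {b : ℕ} (hb : onCode b = true) : OnBoard 19 15 (pt b) := by
  rw [onCode, testBit_full] at hb
  refine ⟨?_, ?_, ?_, ?_⟩ <;> simp only [pt] <;> omega

theorem scan_spec {d : Dir} {c : Finset (ℤ × ℤ)} {m b q r : ℕ} (hb : onCode b = true)
    (hs : scan d b m = some (q, r)) (hA : Agrees c m (r ||| 2 ^ q)) :
    ∃ n : ℕ, (∀ i : ℕ, 1 ≤ i → i ≤ n → ray (pt b) d.vec i ∈ c) ∧
        (∀ j, r.testBit j = true ↔
          ∃ i : ℕ, 1 ≤ i ∧ i ≤ n ∧ code (ray (pt b) d.vec i) = j) ∧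
        ray (pt b) d.vec (n + 1) ∉ c ∧ q = code (ray (pt b) d.vec (n + 1)) ∧
        0 ≤ (ray (pt b) d.vec (n + 1)).1 ∧ (ray (pt b) d.vec (n + 1)).1 ≤ 16 ∧
        0 ≤ (ray (pt b) d.vec (n + 1)).2 := by
  obtain ⟨h₁, h₂, h₃, h₄⟩ := onBoard_pt hb
  obtain ⟨v₁, v₂, v₃, v₄, v₅⟩ := d.vec_bounds
  have hcode := code_pt b
  have e₁ : (ray (pt b) d.vec ((0 : ℕ) + 1)).1 = (pt b).1 + d.vec.1 := by simp [ray]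
  have e₂ : (ray (pt b) d.vec ((0 : ℕ) + 1)).2 = (pt b).2 + d.vec.2 := by simp [ray]
  refine slide_spec 20 (k := 0) hs hA ?_ (by omega) (by omega) (by omega)
    (fun i h h' => by omega) (fun j => ?_)
  · simp only [code, e₁, e₂] at hcode ⊢
    omega
  · simp only [Nat.zero_testBit, Bool.false_eq_true, false_iff]
    rintro ⟨i, h, h', -⟩
    omega

/-- The hop in direction `d` of the ball at `b` on the bitboard `m`: the landing point, the
remaining chaps, and the zone inspected. -/
def hop (d : Dir) (b m : ℕ) : Option (ℕ × ℕ × ℕ) :=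
  match scan d b m with
  | none => none
  | some (q, r) => if r == 0 || q % 16 == 0 then none else some (q, m ^^^ r, r ||| 2 ^ q)

theorem hop_spec {d : Dir} {c : Finset (ℤ × ℤ)} {m b b' m' z : ℕ} (hb : onCode b = true)
    (h : hop d b m = some (b', m', z)) (hA : Agrees c m z) :
    ∃ c', HopIn d (pt b) c (pt b') c' ∧
      (∀ b'' c'', HopIn d (pt b) c b'' c'' → b'' = pt b' ∧ c'' = c') ∧
      ∀ z', Agrees c m z' → Agrees c' m' z' := by
  unfold hop at h
  split at h
  · simp at h
  next q r hs =>
  split at h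
  · simp at h
  next hne =>
  simp only [Option.some.injEq, Prod.mk.injEq] at h
  obtain ⟨rfl, rfl, rfl⟩ := h
  simp only [Bool.or_eq_true, beq_iff_eq, not_or] at hne
  obtain ⟨hr0, hq0⟩ := hne
  obtain ⟨n, hc, hr, hland, hq, hx, hx', hy⟩ := scan_spec hb hs hA
  have hn : 1 ≤ n := by
    by_contra hn
    refine hr0 (Nat.eq_of_testBit_eq fun j => ?_)
    rw [Nat.zero_testBit, Bool.eq_false_iff, ne_eq, hr]
    rintro ⟨i, h, h', -⟩
    omega
  have hcol : 1 ≤ (ray (pt b) d.vec (n + 1)).1 ∧ (ray (pt b) d.vec (n + 1)).1 ≤ 15 := by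
    unfold code at hq
    omega
  have hpt : pt q = ray (pt b) d.vec (n + 1) := by
    rw [hq]
    exact pt_code (by omega) (by omega) (by omega)
  refine ⟨_, ⟨n, hn, hc, hland, hcol.1, hcol.2, hpt, rfl⟩, ?_, fun z' hz' => ?_⟩
  · rintro b'' c'' ⟨k, hk, hkc, hkl, -, -, rfl, rfl⟩
    obtain rfl : k = n := by
      rcases lt_trichotomy k n with h | h | h
      · exact absurd (by simpa using hc (k + 1) (by omega) h) hkl
      · exact h
      · exact absurd (by simpa using hkc (n + 1) (by omega) h) hland
    exact ⟨hpt.symm, rfl⟩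
  · refine ⟨fun p hp => hA.onBoard p (Finset.mem_sdiff.1 hp).1, fun p hp hzp => ?_⟩
    rw [Finset.mem_sdiff, Finset.mem_image, Nat.testBit_xor]
    by_cases hrp : r.testBit (code p) = true
    · have hmp : m.testBit (code p) = true := by
        obtain ⟨i, h₁, h₂, h₃⟩ := (hr _).1 hrp
        have hi := hA.onBoard _ (hc i h₁ h₂)
        rw [← h₃, ← hA.iff _ hi (by simp [h₃, hrp])]
        exact hc i h₁ h₂
      obtain ⟨i, h₁, h₂, h₃⟩ := (hr _).1 hrp
      have hi := hA.onBoard _ (hc i h₁ h₂)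
      simp only [hrp, hmp, bne_self_eq_false, Bool.false_eq_true, iff_false, not_and, not_not]
      exact fun _ => ⟨i, by simp [h₁, h₂], hi.eq_of_code_eq hp h₃⟩
    · rw [hz'.iff p hp hzp, Bool.eq_false_iff.2 hrp, Bool.xor_false, and_iff_left_iff_imp]
      rintro - ⟨i, hi, rfl⟩
      rw [Finset.mem_Icc] at hi
      exact hrp ((hr _).2 ⟨i, hi.1, hi.2, rfl⟩)

/-- The zone showing that the ball at `b` has no hop in direction `d`, if this is the case. -/
def noHop (d : Dir) (b m : ℕ) : Option ℕ :=
  match scan d b m with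
  | none => none
  | some (q, r) => if r == 0 || q % 16 == 0 then some (r ||| 2 ^ q) else none

theorem noHop_spec {d : Dir} {c : Finset (ℤ × ℤ)} {m b z : ℕ} (hb : onCode b = true)
    (h : noHop d b m = some z) (hA : Agrees c m z) (b' : ℤ × ℤ) (c' : Finset (ℤ × ℤ)) :
    ¬ HopIn d (pt b) c b' c' := by
  unfold noHop at h
  split at h
  · simp at h
  next q r hs =>
  split at h
  next hne =>
    simp only [Option.some.injEq] at h
    subst h
    obtain ⟨n, hc, hr, hland, hq, hx, hx', hy⟩ := scan_spec hb hs hA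
    rintro ⟨k, hk, hkc, hkl, hk₁, hk₂, -⟩
    obtain rfl : k = n := by
      rcases lt_trichotomy k n with h | h | h
      · exact absurd (by simpa using hc (k + 1) (by omega) h) hkl
      · exact h
      · exact absurd (by simpa using hkc (n + 1) (by omega) h) hland
    simp only [Bool.or_eq_true, beq_iff_eq] at hne
    rcases hne with h0 | h0
    · have := (hr (code (ray (pt b) d.vec 1))).2 ⟨1, le_rfl, hk, by simp⟩
      simp [h0] at this
    · unfold code at hq
      omega
  · simp at h

/-- Perform the hops in the given directions: the final point of the ball, the remaining chaps,
and the zone inspected. -/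
def run : List Dir → ℕ → ℕ → Option (ℕ × ℕ × ℕ)
  | [], _, _ => none
  | [d], b, m => hop d b m
  | d :: ds, b, m =>
    match hop d b m with
    | none => none
    | some (b₁, m₁, z₁) =>
      if onCode b₁ then
        match run ds b₁ m₁ with
        | none => none
        | some (b', m', z') => some (b', m', z₁ ||| z')
      else none

theorem run_spec : ∀ (ds : List Dir) {c : Finset (ℤ × ℤ)} {m b b' m' z : ℕ},
    onCode b = true → run ds b m = some (b', m', z) → Agrees c m z →
    ∃ c', Jump 19 15 (pt b) c (pt b') c' ∧ ∀ z', Agrees c m z' → Agrees c' m' z'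
  | [], _, _, _, _, _, _ => by simp [run]
  | [d], c, m, b, b', m', z => by
    intro hb h hA
    obtain ⟨c', h₁, -, h₂⟩ := hop_spec hb (by simpa [run] using h) hA
    exact ⟨c', .single (hop_iff.2 ⟨d, h₁⟩), h₂⟩
  | d :: d' :: ds, c, m, b, b', m', z => by
    intro hb h hA
    simp only [run] at h
    split at h
    · simp at h
    next b₁ m₁ z₁ h₁ =>
    split at h
    next hb₁ =>
      split at h
      · simp at h
      next b₂ m₂ z₂ h₂ =>
      simp only [Option.some.injEq, Prod.mk.injEq] at h
      obtain ⟨rfl, rfl, rfl⟩ := h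
      obtain ⟨c₁, hop₁, -, hA₁⟩ := hop_spec hb h₁ hA.left
      obtain ⟨c', hj, hA'⟩ := run_spec (d' :: ds) hb₁ h₂ (hA₁ _ hA.right)
      obtain ⟨-, -, h₃, h₄⟩ := onBoard_pt hb₁
      exact ⟨c', .cons (hop_iff.2 ⟨d, hop₁⟩) h₃ h₄ hj, fun z' hz' => hA' _ (hA₁ _ hz')⟩
    · simp at h

/-! ### Certificates -/

mutual

/-- A certificate that a player who is to move, or has just won, forces a win or a return to a
list of positions. -/
inductive Cert
  /-- The ball lies at or beyond the player's goalline. -/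
  | won
  /-- The position is in the list. -/
  | loop
  /-- The jump in the given directions wins. -/
  | finish (ds : List Dir)
  /-- Place a chap in column `x` and row `y`. -/
  | place (x y : ℕ) (r : Reply)
  /-- Jump in the given directions. -/
  | jump (ds : List Dir) (r : Reply)

/-- A certificate dealing with all moves of the opponent: one certificate for the placements
that do not interfere with it, exceptional placements, and jumps. -/
inductive Reply
  | mk (c : Cert) (es : Places) (js : Hops)

/-- Certificates for individual placements of the opponent. -/
inductive Places
  | nil
  | cons (x y : ℕ) (c : Cert) (es : Places)

/-- Certificates for the opponent's jumps, by direction of the first hop: one certificate in case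
the jump stops there, and certificates for its continuations. -/
inductive Hops
  | nil
  | cons (d : Dir) (c : Cert) (sub : Hops) (js : Hops)

end

/-- The directions listed. -/
def Hops.dirs : Hops → List Dir
  | .nil => []
  | .cons d _ _ js => d :: js.dirs

/-- The certificate starts with a move. -/
def Cert.isMove : Cert → Bool
  | .won => false
  | .loop => false
  | .finish _ => true
  | .place _ _ _ => true
  | .jump _ _ => true

/-- The zone showing that the ball at `b` has no hop outside the directions `ds`. -/
def noHopOutside (ds : List Dir) (b m : ℕ) : List Dir → Option ℕ
  | [] => some 0
  | d :: l =>
    match noHopOutside ds b m l with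
    | none => none
    | some z =>
      if d ∈ ds then some z else
        match noHop d b m with
        | none => none
        | some y => some (z ||| y)

/-- A ball at `b` is at or beyond the goalline of `P`. -/
def atGoal (P : Player) (b : ℕ) : Bool := bif P then Nat.ble 304 b else Nat.ble b 31

/-- A ball at `b` is on the board and not on a goalline. -/
def inPlay (b : ℕ) : Bool := onCode b && Nat.ble 32 b && Nat.ble b 303

mutual

/-- Check a certificate with the ball at `b` and chaps `m`, returning the zone inspected. -/
def Cert.check (P : Player) (G : List (ℕ × ℕ)) : Cert → ℕ → ℕ → Option ℕ
  | .won, b, _ => if atGoal P b then some 0 else none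
  | .loop, b, m => if (b, m) ∈ G then some full else none
  | .finish ds, b, m =>
    if inPlay b then
      match run ds b m with
      | none => none
      | some (b', _, z) => if atGoal P b' then some z else none
    else none
  | .place x y r, b, m =>
    if inPlay b && onCode (16 * y + x) && !m.testBit (16 * y + x) && 16 * y + x != b then
      match r.check P G b (m ||| 2 ^ (16 * y + x)) with
      | none => none
      | some z => some (z ||| 2 ^ (16 * y + x))
    else none
  | .jump ds r, b, m =>
    if inPlay b then
      match run ds b m with
      | none => none
      | some (b', m', z) =>
        match r.check P G b' m' with
        | none => none
        | some z' => some (z ||| z')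
    else none

/-- Check a certificate for the opponent's moves, returning the zone inspected. -/
def Reply.check (P : Player) (G : List (ℕ × ℕ)) : Reply → ℕ → ℕ → Option ℕ
  | .mk c es js, b, m =>
    if inPlay b then
      match c.check P G b m, es.check P G b m, js.check P G b m,
          noHopOutside js.dirs b m Dir.all with
      | some z₀, some (z₁, u), some z₂, some z₃ =>
        if (z₀ &&& full) ||| (m ||| u ||| 2 ^ b) == m ||| u ||| 2 ^ b then
          some (z₀ ||| z₁ ||| (z₂ ||| z₃))
        else none
      | _, _, _, _ => none
    else none

/-- Check certificates for placements, returning the zone inspected and the points covered. -/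
def Places.check (P : Player) (G : List (ℕ × ℕ)) : Places → ℕ → ℕ → Option (ℕ × ℕ)
  | .nil, _, _ => some (0, 0)
  | .cons x y c es, b, m =>
    match c.check P G b (m ||| 2 ^ (16 * y + x)), es.check P G b m with
    | some z, some (z', u) => some (z ||| z', 2 ^ (16 * y + x) ||| u)
    | _, _ => none

/-- Check certificates for jumps, returning the zone inspected. -/
def Hops.check (P : Player) (G : List (ℕ × ℕ)) : Hops → ℕ → ℕ → Option ℕ
  | .nil, _, _ => some 0
  | .cons d c sub js, b, m =>
    match hop d b m with
    | none => none
    | some (b', m', z) =>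
      match c.check P G b' m', js.check P G b m with
      | some z₀, some z₁ =>
        if onCode b' then
          match sub.check P G b' m', noHopOutside sub.dirs b' m' Dir.all with
          | some z₂, some z₃ => some (z ||| z₀ ||| z₁ ||| (z₂ ||| z₃))
          | _, _ => none
        else some (z ||| z₀ ||| z₁)
      | _, _ => none

end

theorem noHopOutside_spec {ds : List Dir} {b m : ℕ} {c : Finset (ℤ × ℤ)}
    (hb : onCode b = true) : ∀ {l : List Dir} {z : ℕ},
    noHopOutside ds b m l = some z → Agrees c m z → ∀ d ∈ l, d ∉ ds → ∀ b' c',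
      ¬ HopIn d (pt b) c b' c'
  | [], _ => by simp
  | a :: l, z => by
    intro h hA d hd hds b' c'
    simp only [noHopOutside] at h
    split at h
    · simp at h
    next z₁ h₁ =>
    split at h
    next ha =>
      simp only [Option.some.injEq] at h
      subst h
      rcases List.mem_cons.1 hd with rfl | hd
      · exact absurd ha hds
      · exact noHopOutside_spec hb h₁ hA d hd hds b' c'
    next ha =>
      split at h
      · simp at h
      next z₂ h₂ =>
      simp only [Option.some.injEq] at h
      subst h
      rcases List.mem_cons.1 hd with rfl | hd
      · exact noHop_spec hb h₂ hA.right b' c'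
      · exact noHopOutside_spec hb h₁ hA.left d hd hds b' c'

theorem winner_of_atGoal {P : Player} {b : ℕ} (h : atGoal P b = true) (c : Finset (ℤ × ℤ))
    (Q : Player) : winner 19 ⟨pt b, c, Q⟩ = some P := by
  cases P <;> simp only [atGoal, cond_true, cond_false, Nat.ble_eq] at h
  · have h₁ : ¬ (19 : ℤ) ≤ (pt b).2 := by simp only [pt]; omega
    have h₂ : (pt b).2 ≤ 1 := by simp only [pt]; omega
    simp [winner, h₁, h₂]
  · have h₁ : (19 : ℤ) ≤ (pt b).2 := by simp only [pt]; omega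
    simp [winner, h₁]

theorem onCode_of_inPlay {b : ℕ} (h : inPlay b = true) : onCode b = true := by
  simp only [inPlay, Bool.and_eq_true] at h
  exact h.1.1

theorem winner_of_inPlay {b : ℕ} (h : inPlay b = true) (c : Finset (ℤ × ℤ)) (Q : Player) :
    winner 19 ⟨pt b, c, Q⟩ = none := by
  simp only [inPlay, Bool.and_eq_true, Nat.ble_eq] at h
  have h₁ : ¬ (19 : ℤ) ≤ (pt b).2 := by simp only [pt]; omega
  have h₂ : ¬ (pt b).2 ≤ 1 := by simp only [pt]; omega
  simp [winner, h₁, h₂]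

/-- The positions with `P` to move given by a list of ball codes and bitboards. -/
def InList (P : Player) (G : List (ℕ × ℕ)) (s : PState) : Prop :=
  ∃ i ∈ G, s = ⟨pt i.1, pointsOf i.2, P⟩

/-- The conclusion drawn from a certificate for `P` to move. -/
def Sound (P : Player) (G : List (ℕ × ℕ)) (s : PState) (q : Bool) : Prop :=
  Forced P (InList P G) s ∧
    (q = true → winner 19 s = none ∧ ∃ t, MoveRel 19 15 s t ∧ Forced P (InList P G) t)

theorem Sound.of_move {P : Player} {G : List (ℕ × ℕ)} {s t : PState} {q : Bool}
    (h₁ : winner 19 s = none) (h₂ : s.turn = P) (h₃ : MoveRel 19 15 s t)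
    (h₄ : Forced P (InList P G) t) : Sound P G s q :=
  ⟨.mine h₁ h₂ h₃ h₄, fun _ => ⟨h₁, t, h₃, h₄⟩⟩

theorem forced_of_jump {F : PState → Prop} {P : Player} {b : ℤ × ℤ} {c : Finset (ℤ × ℤ)}
    {ds : List Dir}
    (h : ∀ d ∈ ds, ∀ b' c', HopIn d b c b' c' → F ⟨b', c', P⟩ ∧
      (1 ≤ b'.2 → b'.2 ≤ 19 → ∀ b'' c'', Jump 19 15 b' c' b'' c'' → F ⟨b'', c'', P⟩))
    (h' : ∀ d ∈ Dir.all, d ∉ ds → ∀ b' c', ¬ HopIn d b c b' c') (b' : ℤ × ℤ)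
    (c' : Finset (ℤ × ℤ)) (hj : Jump 19 15 b c b' c') : F ⟨b', c', P⟩ := by
  have listed : ∀ d b' c', HopIn d b c b' c' → d ∈ ds := fun d b' c' hd => by
    by_contra hds
    exact h' d d.mem_all hds b' c' hd
  cases hj with
  | single hh =>
    obtain ⟨d, hd⟩ := hop_iff.1 hh
    exact (h d (listed d _ _ hd) _ _ hd).1
  | cons hh h₁ h₂ hj =>
    obtain ⟨d, hd⟩ := hop_iff.1 hh
    exact (h d (listed d _ _ hd) _ _ hd).2 h₁ h₂ _ _ hj

mutual

theorem Cert.check_sound {P : Player} {G : List (ℕ × ℕ)} :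
    ∀ (k : Cert) {b m z : ℕ} {c : Finset (ℤ × ℤ)}, k.check P G b m = some z → Agrees c m z →
      Sound P G ⟨pt b, c, P⟩ k.isMove
  | .won, b, m, z, c => by
    intro h hA
    rw [Cert.check] at h
    split at h
    next hw => exact ⟨.won (winner_of_atGoal hw _ _), fun h => by simp [Cert.isMove] at h⟩
    · simp at h
  | .loop, b, m, z, c => by
    intro h hA
    rw [Cert.check] at h
    split at h
    next hG =>
      simp only [Option.some.injEq] at h
      subst h
      exact ⟨.base ⟨_, hG, by rw [hA.eq_pointsOf]⟩, fun h => by simp [Cert.isMove] at h⟩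
    · simp at h
  | .finish ds, b, m, z, c => by
    intro h hA
    rw [Cert.check] at h
    split at h
    next hb =>
      split at h
      · simp at h
      next b' m' z' hr =>
      split at h
      next hw =>
        simp only [Option.some.injEq] at h
        subst h
        obtain ⟨c', hj, -⟩ := run_spec ds (onCode_of_inPlay hb) hr hA
        exact .of_move (t := ⟨pt b', c', !P⟩) (winner_of_inPlay hb _ _) rfl ⟨rfl, .inr hj⟩
          (.won (winner_of_atGoal hw _ _))
      · simp at h
    · simp at h
  | .place x y r, b, m, z, c => by
    intro h hA
    rw [Cert.check] at h
    generalize 16 * y + x = q at h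
    split at h
    next hb =>
      simp only [Bool.and_eq_true, Bool.not_eq_true', bne_iff_ne] at hb
      obtain ⟨⟨⟨hb, hq⟩, hm⟩, hne⟩ := hb
      split at h
      · simp at h
      next z' hr =>
      simp only [Option.some.injEq] at h
      subst h
      have hp := onBoard_pt hq
      have hins := hA.left.insert hp
      rw [code_pt] at hins
      refine .of_move (t := ⟨pt b, insert (pt q) c, !P⟩) (winner_of_inPlay hb _ _) rfl
        ⟨rfl, .inl ⟨pt q, hp, fun hc => ?_, fun he => hne ?_, rfl, rfl⟩⟩
        (r.check_sound hr hins)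
      · rw [hA.iff _ hp (by simp [code_pt]), code_pt, hm] at hc
        simp at hc
      · rw [← code_pt q, he, code_pt]
    · simp at h
  | .jump ds r, b, m, z, c => by
    intro h hA
    rw [Cert.check] at h
    split at h
    next hb =>
      split at h
      · simp at h
      next b' m' z₁ hr =>
      split at h
      · simp at h
      next z₂ hr' =>
      simp only [Option.some.injEq] at h
      subst h
      obtain ⟨c', hj, hA'⟩ := run_spec ds (onCode_of_inPlay hb) hr hA.left
      exact .of_move (t := ⟨pt b', c', !P⟩) (winner_of_inPlay hb _ _) rfl ⟨rfl, .inr hj⟩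
        (r.check_sound hr' (hA' _ hA.right))
    · simp at h

theorem Reply.check_sound {P : Player} {G : List (ℕ × ℕ)} :
    ∀ (k : Reply) {b m z : ℕ} {c : Finset (ℤ × ℤ)}, k.check P G b m = some z → Agrees c m z →
      Forced P (InList P G) ⟨pt b, c, !P⟩
  | .mk k es js, b, m, z, c => by
    intro h hA
    rw [Reply.check] at h
    split at h
    next hb =>
      split at h
      next z₀ z₁ u z₂ z₃ h₀ h₁ h₂ h₃ =>
        split at h
        next hu =>
          simp only [Option.some.injEq] at h
          subst h
          rw [beq_iff_eq] at hu
          refine .theirs (winner_of_inPlay hb _ _) rfl ?_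
          rintro ⟨b', c', t⟩ ⟨ht, hmove⟩
          obtain rfl : t = P := by simpa using ht
          rcases hmove with ⟨p, hp, hpc, hpb, hb', hc'⟩ | hj
          · dsimp only at hpc hpb hb' hc'
            subst hb' hc'
            by_cases hz : z₀.testBit (code p) = true
            · have hpu : (m ||| u ||| 2 ^ b).testBit (code p) = true := by
                rw [← hu, Nat.testBit_or, Nat.testBit_and, hz, testBit_full_code hp]
                rfl
              simp only [Nat.testBit_or, Bool.or_eq_true, Nat.testBit_two_pow,
                decide_eq_true_eq] at hpu
              rcases hpu with (hpm | hpu) | hpu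
              · exact absurd ((hA.left.left.iff p hp hz).2 hpm) hpc
              · exact es.check_sound h₁ hA.left.right p hp hpu
              · exact absurd (by rw [hpu, hp.pt_code]) hpb
            · exact (k.check_sound h₀ (hA.left.left.insert_of_not_mem hp hz)).1
          · exact forced_of_jump (js.check_sound (onCode_of_inPlay hb) h₂ hA.right.left)
              (noHopOutside_spec (onCode_of_inPlay hb) h₃ hA.right.right) _ _ hj
        · simp at h
      · simp at h
    · simp at h

theorem Places.check_sound {P : Player} {G : List (ℕ × ℕ)} :
    ∀ (k : Places) {b m z u : ℕ} {c : Finset (ℤ × ℤ)}, k.check P G b m = some (z, u) →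
      Agrees c m z → ∀ p, OnBoard 19 15 p → u.testBit (code p) = true →
        Forced P (InList P G) ⟨pt b, insert p c, P⟩
  | .nil, b, m, z, u, c => by
    intro h hA p hp hu
    simp only [Places.check, Option.some.injEq, Prod.mk.injEq] at h
    simp [← h.2] at hu
  | .cons x y k es, b, m, z, u, c => by
    intro h hA p hp hu
    rw [Places.check] at h
    generalize 16 * y + x = q at h
    split at h
    next z₀ z₁ u' h₀ h₁ =>
      simp only [Option.some.injEq, Prod.mk.injEq] at h
      obtain ⟨rfl, rfl⟩ := h
      rw [Nat.testBit_or, Bool.or_eq_true, Nat.testBit_two_pow, decide_eq_true_eq] at hu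
      rcases hu with rfl | hu
      · exact (k.check_sound h₀ (hA.left.insert hp)).1
      · exact es.check_sound h₁ hA.right p hp hu
    · simp at h

theorem Hops.check_sound {P : Player} {G : List (ℕ × ℕ)} :
    ∀ (k : Hops) {b m z : ℕ} {c : Finset (ℤ × ℤ)}, onCode b = true → k.check P G b m = some z →
      Agrees c m z → ∀ d ∈ k.dirs, ∀ b' c', HopIn d (pt b) c b' c' →
        Forced P (InList P G) ⟨b', c', P⟩ ∧
        (1 ≤ b'.2 → b'.2 ≤ 19 → ∀ b'' c'', Jump 19 15 b' c' b'' c'' →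
          Forced P (InList P G) ⟨b'', c'', P⟩)
  | .nil, b, m, z, c => by simp [Hops.dirs]
  | .cons a k sub js, b, m, z, c => by
    intro hb h hA d hd b' c' hd'
    rw [Hops.check] at h
    split at h
    · simp at h
    next q m' z' hh =>
    split at h
    next z₀ z₁ h₀ h₁ =>
      split at h
      next hq =>
        split at h
        next z₂ z₃ h₂ h₃ =>
          simp only [Option.some.injEq] at h
          subst h
          rcases List.mem_cons.1 hd with rfl | hd
          · obtain ⟨c₁, -, huniq, hA'⟩ := hop_spec hb hh hA.left.left.left
            obtain ⟨rfl, rfl⟩ := huniq _ _ hd'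
            exact ⟨(k.check_sound h₀ (hA' _ hA.left.left.right)).1, fun _ _ =>
              forced_of_jump (sub.check_sound hq h₂ (hA' _ hA.right.left))
                (noHopOutside_spec hq h₃ (hA' _ hA.right.right))⟩
          · exact js.check_sound hb h₁ hA.left.right d hd b' c' hd'
        · simp at h
      next hq =>
        simp only [Option.some.injEq] at h
        subst h
        rcases List.mem_cons.1 hd with rfl | hd
        · obtain ⟨c₁, -, huniq, hA'⟩ := hop_spec hb hh hA.left.left
          obtain ⟨rfl, rfl⟩ := huniq _ _ hd'
          refine ⟨(k.check_sound h₀ (hA' _ hA.left.right)).1, fun hy hy' => absurd ?_ hq⟩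
          obtain ⟨n, -, -, -, hx, hx', he, -⟩ := hd'
          rw [onCode, ← code_pt q]
          exact testBit_full_code ⟨by rwa [he], by rwa [he], hy, hy'⟩
        · exact js.check_sound hb h₁ hA.right d hd b' c' hd'
    · simp at h

end

/-! ### The cycle through `R0`

Starting from `R0` the players alternately place the chaps b3, c4, …, m14 of a diagonal, Alfred
jumps over them from a2 to n15, the players place the same chaps in the opposite order, and Betty
jumps back. -/

/-- The bitboard of the chaps of `R0`. -/
def chapsR0 : ℕ :=
  1757679238164991448731053940368465725008085604675682489962272636440557017556028869095910713851904

/-- The chaps of `R0` together with the first `k` chaps of the diagonal from b3 to m14. -/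
def first (k : ℕ) : ℕ :=
  (List.range k).foldl (fun m i => m ||| 2 ^ (50 + 17 * i)) chapsR0

/-- The chaps of `R0` together with the last `k` chaps of the diagonal from b3 to m14. -/
def last (k : ℕ) : ℕ :=
  (List.range k).foldl (fun m i => m ||| 2 ^ (237 - 17 * i)) chapsR0

/-- A certificate for Alfred starting with a chap at d6. -/
def alfredAfterD6 : Cert :=
  .place 4 6 (.mk (.finish [.w, .n, .n]) (.cons 3 6 (.finish [.w, .ne, .nw, .e, .ne, .ne, .nw,
  .ne, .nw]) <| .cons 3 8 (.finish [.w, .n]) .nil) (.cons .w (.finish [.n, .n]) (.cons .n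
  (.finish [.n]) (.cons .n .won .nil .nil) .nil) .nil))

/-- A certificate for Alfred starting with a chap at c5. -/
def alfredAfterC5 : Cert :=
  .place 3 5 (.mk (.finish [.n, .n, .n]) (.cons 3 6 (.finish [.n, .n]) <| .cons 3 8 (.finish [.n,
  .n]) .nil) (.cons .n (.finish [.n, .n]) (.cons .n (.finish [.n]) (.cons .n .won .nil .nil)
  .nil) .nil))

/-- A certificate for Alfred starting with a chap at a2. -/
def alfredAfterA2 : Cert :=
  .place 1 2 (.mk (.place 14 16 (.mk (.finish [.n]) .nil (.cons .n .won .nil .nil))) (.cons 14 14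
  (.finish [.s, .nw, .ne, .ne]) <| .cons 13 15 (.finish [.w, .ne, .nw]) <| .cons 13 16 (.finish
  [.nw, .ne]) <| .cons 14 16 (.finish [.n]) .nil) .nil)

/-- A certificate for Alfred starting with a chap at k17. -/
def alfredAfterK17 : Cert :=
  .place 11 17 (.mk (.finish [.n, .ne]) (.cons 11 18 (.finish [.n]) .nil) (.cons .n (.finish
  [.ne]) (.cons .e (.finish [.ne]) (.cons .ne .won .nil <| .cons .nw .won .nil .nil) <| .cons .ne
  .won .nil .nil) .nil))

/-- A certificate for Alfred starting with a chap at l11. -/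
def alfredAfterL11 : Cert :=
  .place 12 11 (.mk (.finish [.nw, .nw, .n]) (.cons 11 12 (.finish [.nw, .n]) <| .cons 9 14
  (.finish [.nw, .nw, .ne, .nw]) .nil) (.cons .nw (.finish [.nw, .n]) (.cons .e (.place 12 12
  (.mk (.finish [.w, .nw, .n]) (.cons 11 12 (.finish [.w, .n, .nw, .ne, .nw]) <| .cons 9 14
  (.finish [.w, .nw, .ne, .nw]) .nil) (.cons .w (.finish [.nw, .n]) (.cons .nw (.finish [.n])
  (.cons .n .won .nil .nil) .nil) .nil))) .nil <| .cons .nw (.finish [.n]) (.cons .n .won .nil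
  .nil) .nil) .nil))

/-- A certificate for Alfred starting with a chap at j10. -/
def alfredAfterJ10 : Cert :=
  .place 10 10 (.mk (.finish [.w, .nw, .n]) (.cons 9 10 (.finish [.w, .n, .nw, .nw, .ne, .ne]) <|
  .cons 7 12 (.finish [.w, .nw, .ne, .ne, .nw]) .nil) (.cons .e (.place 12 10 (.mk (.finish [.w,
  .w, .nw, .n]) (.cons 9 10 (.finish [.w, .w, .n, .nw, .ne, .ne, .nw]) <| .cons 11 10 (.finish
  [.w, .nw, .n]) <| .cons 7 12 (.finish [.w, .w, .nw, .nw, .ne, .ne]) .nil) (.cons .w (.finish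
  [.w, .nw, .n]) (.cons .w (.finish [.nw, .n]) (.cons .nw (.finish [.n]) (.cons .n .won .nil
  .nil) .nil) .nil) .nil))) .nil <| .cons .w (.finish [.nw, .n]) (.cons .nw (.finish [.n]) (.cons
  .n .won .nil .nil) .nil) .nil))

/-- A certificate for Alfred starting with a chap at m13. -/
def alfredAfterM13 : Cert :=
  .place 13 13 (.mk (.finish [.n, .nw, .ne, .ne]) (.cons 13 14 (.finish [.n, .nw, .ne]) <| .cons
  11 16 (.finish [.n, .nw, .nw]) <| .cons 13 18 (.finish [.n, .nw, .ne]) .nil) (.cons .n (.finish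
  [.nw, .ne, .ne]) (.cons .nw (.finish [.ne, .ne]) (.cons .e (.finish [.nw, .ne]) (.cons .nw
  (.finish [.ne]) (.cons .e (.finish [.ne]) (.cons .ne .won .nil <| .cons .nw .won .nil .nil) <|
  .cons .ne .won .nil .nil) .nil) <| .cons .ne (.finish [.ne]) (.cons .ne .won .nil <| .cons .nw
  .won .nil <| .cons .w (.finish [.ne]) (.cons .ne .won .nil .nil) .nil) .nil) .nil) .nil))

/-- A certificate for Betty starting with a chap at b4. -/
def bettyAfterB4 : Cert :=
  .place 2 4 (.mk (.finish [.s, .se]) (.cons 4 1 (.finish [.s, .se]) <| .cons 2 3 (.finish [.s,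
  .se]) .nil) (.cons .s (.finish [.se]) (.cons .se .won (.cons .w .won .nil .nil) .nil) .nil))

/-- A certificate for Betty starting with a chap at l12. -/
def bettyAfterL12 : Cert :=
  .place 12 12 (.mk (.finish [.s, .s, .s]) (.cons 12 9 (.finish [.s, .s]) <| .cons 12 11 (.finish
  [.s, .s]) .nil) (.cons .s (.finish [.s, .s]) (.cons .s (.finish [.s]) (.cons .s .won .nil .nil)
  .nil) .nil))

/-- A certificate for Betty starting with a chap at k11. -/
def bettyAfterK11 : Cert :=
  .place 11 11 (.mk (.finish [.e, .s, .s]) (.cons 12 9 (.finish [.e, .s]) <| .cons 12 11 (.finish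
  [.e, .sw, .se, .sw, .se, .sw]) .nil) (.cons .e (.finish [.s, .s]) (.cons .s (.finish [.s])
  (.cons .s .won .nil .nil) .nil) .nil))

/-- A certificate for Betty starting with a chap at n15. -/
def bettyAfterN15 : Cert :=
  .place 14 15 (.mk (.place 1 1 (.mk (.finish [.s]) .nil (.cons .s .won .nil .nil))) (.cons 1 1
  (.finish [.s]) <| .cons 2 1 (.finish [.se]) <| .cons 2 2 (.finish [.e, .sw]) <| .cons 1 3
  (.finish [.n, .se]) .nil) .nil)

/-- A certificate for Betty starting with a chap at c6. -/
def bettyAfterC6 : Cert :=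
  .place 3 6 (.mk (.finish [.se, .se, .s]) (.cons 6 3 (.finish [.se, .se, .sw]) <| .cons 4 5
  (.finish [.se, .s]) .nil) (.cons .se (.finish [.se, .s]) (.cons .w bettyAfterB4 .nil <| .cons
  .se (.finish [.s]) (.cons .s .won .nil .nil) .nil) .nil))

/-- A certificate for Betty starting with a chap at e7. -/
def bettyAfterE7 : Cert :=
  .place 5 7 (.mk (.finish [.e, .se, .s]) (.cons 8 5 (.finish [.e, .se, .sw, .sw]) <| .cons 6 7
  (.finish [.e, .s, .se, .sw]) .nil) (.cons .e (.finish [.se, .s]) (.cons .se (.finish [.s])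
  (.cons .s .won .nil .nil) .nil) <| .cons .w (.place 3 7 (.mk (.finish [.e, .e, .se, .s]) (.cons
  8 5 (.finish [.e, .e, .se, .se, .se]) <| .cons 4 7 (.finish [.e, .se, .s]) <| .cons 6 7
  (.finish [.e, .e, .s, .se, .sw]) .nil) (.cons .e (.finish [.e, .se, .s]) (.cons .e (.finish
  [.se, .s]) (.cons .se (.finish [.s]) (.cons .s .won .nil .nil) .nil) .nil) .nil))) .nil .nil))

/-- A certificate for Alfred with the ball at a2 and 0 diagonal chaps. -/
def alfredUpB3 : Cert :=
  .place 2 3 (.mk (.finish [.ne, .n, .n, .n]) (.cons 3 4 .loop <| .cons 3 6 (.finish [.ne, .n,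
  .n]) <| .cons 3 8 (.finish [.ne, .n, .n]) .nil) (.cons .ne (.finish [.n, .n, .n]) (.cons .n
  (.finish [.n, .n]) (.cons .e alfredAfterD6 .nil <| .cons .n (.finish [.n]) (.cons .n .won .nil
  .nil) .nil) .nil) .nil))

/-- A certificate for Alfred with the ball at a2 and 2 diagonal chaps. -/
def alfredUpD5 : Cert :=
  .place 4 5 (.mk (.finish [.ne, .w, .n, .n]) (.cons 3 6 (.finish [.ne, .w, .ne, .nw, .e, .ne,
  .ne, .nw, .nw, .nw]) <| .cons 5 6 .loop <| .cons 3 8 (.finish [.ne, .w, .n]) .nil) (.cons .ne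
  (.finish [.w, .n, .n]) (.cons .w (.finish [.n, .n]) (.cons .n (.finish [.n]) (.cons .n .won
  .nil .nil) <| .cons .s alfredAfterC5 .nil .nil) .nil) .nil))

/-- A certificate for Alfred with the ball at a2 and 4 diagonal chaps. -/
def alfredUpF7 : Cert :=
  .place 6 7 (.mk (.finish [.ne, .nw, .n]) (.cons 7 8 .loop <| .cons 5 10 (.finish [.ne, .nw,
  .ne, .nw, .nw, .ne]) .nil) (.cons .ne (.finish [.nw, .n]) (.cons .nw (.finish [.n]) (.cons .n
  .won .nil .nil) .nil) .nil))

/-- A certificate for Alfred with the ball at a2 and 6 diagonal chaps. -/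
def alfredUpH9 : Cert :=
  .place 8 9 (.mk (.finish [.ne, .nw, .n]) (.cons 9 10 .loop <| .cons 7 12 (.finish [.ne, .nw,
  .ne, .ne, .nw]) .nil) (.cons .ne (.finish [.nw, .n]) (.cons .nw (.finish [.n]) (.cons .n .won
  .nil .nil) .nil) .nil))

/-- A certificate for Alfred with the ball at a2 and 8 diagonal chaps. -/
def alfredUpJ11 : Cert :=
  .place 10 11 (.mk (.finish [.ne, .nw, .n]) (.cons 11 12 .loop <| .cons 9 14 (.finish [.ne, .nw,
  .ne, .nw]) .nil) (.cons .ne (.finish [.nw, .n]) (.cons .e alfredAfterM13 .nil <| .cons .nw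
  (.finish [.n]) (.cons .n .won .nil .nil) <| .cons .s alfredAfterJ10 (.cons .e alfredAfterL11
  .nil .nil) .nil) .nil))

/-- A certificate for Alfred with the ball at a2 and 10 diagonal chaps. -/
def alfredUpL13 : Cert :=
  .place 12 13 (.mk (.finish [.ne, .nw, .ne, .ne]) (.cons 13 14 .loop <| .cons 11 16 (.finish
  [.ne, .nw, .nw]) <| .cons 13 18 (.finish [.ne, .nw, .ne]) .nil) (.cons .ne (.finish [.nw, .ne,
  .ne]) (.cons .nw (.finish [.ne, .ne]) (.cons .e (.finish [.nw, .ne]) (.cons .nw (.finish [.ne])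
  (.cons .e (.finish [.ne]) (.cons .ne .won .nil <| .cons .nw .won .nil .nil) <| .cons .ne .won
  .nil .nil) .nil) <| .cons .ne (.finish [.ne]) (.cons .ne .won .nil <| .cons .nw .won .nil <|
  .cons .w (.finish [.ne]) (.cons .ne .won .nil .nil) .nil) .nil) .nil) .nil))

/-- A certificate for Alfred with the ball at a2 and 12 diagonal chaps. -/
def alfredUpJump : Cert :=
  .jump [.ne] (.mk (.place 14 16 (.mk (.finish [.n]) .nil (.cons .n .won .nil .nil))) (.cons 13
  14 .loop <| .cons 14 14 (.place 14 16 (.mk (.finish [.n]) .nil (.cons .n .won .nil <| .cons .s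
  (.place 14 14 (.mk (.finish [.n, .n]) (.cons 14 15 (.finish [.n]) .nil) (.cons .n (.finish
  [.n]) (.cons .n .won .nil .nil) .nil))) .nil .nil))) <| .cons 13 15 (.finish [.w, .ne, .nw]) <|
  .cons 13 16 (.finish [.nw, .ne]) <| .cons 14 16 (.finish [.n]) .nil) .nil)

/-- A certificate for Alfred with the ball at n15 and 1 diagonal chaps. -/
def alfredDownL13 : Cert :=
  .place 12 13 (.mk (.finish [.sw, .nw, .n]) (.cons 11 12 .loop <| .cons 9 14 (.finish [.sw, .nw,
  .ne, .nw]) .nil) (.cons .sw (.finish [.nw, .n]) (.cons .e alfredAfterM13 .nil <| .cons .nw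
  (.finish [.n]) (.cons .n .won .nil .nil) <| .cons .s alfredAfterJ10 (.cons .e alfredAfterL11
  .nil .nil) .nil) .nil))

/-- A certificate for Alfred with the ball at n15 and 3 diagonal chaps. -/
def alfredDownJ11 : Cert :=
  .place 10 11 (.mk (.finish [.sw, .nw, .n]) (.cons 9 10 .loop <| .cons 7 12 (.finish [.sw, .nw,
  .ne, .ne, .nw]) .nil) (.cons .sw (.finish [.nw, .n]) (.cons .nw (.finish [.n]) (.cons .n .won
  .nil .nil) .nil) .nil))

/-- A certificate for Alfred with the ball at n15 and 5 diagonal chaps. -/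
def alfredDownH9 : Cert :=
  .place 8 9 (.mk (.finish [.sw, .nw, .n]) (.cons 7 8 .loop <| .cons 5 10 (.finish [.sw, .nw,
  .ne, .nw, .nw, .ne]) .nil) (.cons .sw (.finish [.nw, .n]) (.cons .nw (.finish [.n]) (.cons .n
  .won .nil .nil) .nil) .nil))

/-- A certificate for Alfred with the ball at n15 and 7 diagonal chaps. -/
def alfredDownF7 : Cert :=
  .place 6 7 (.mk (.finish [.sw, .w, .n, .n]) (.cons 3 6 (.finish [.sw, .w, .ne, .nw, .e, .ne,
  .ne, .nw, .nw, .nw]) <| .cons 5 6 .loop <| .cons 3 8 (.finish [.sw, .w, .n]) .nil) (.cons .sw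
  (.finish [.w, .n, .n]) (.cons .w (.finish [.n, .n]) (.cons .n (.finish [.n]) (.cons .n .won
  .nil .nil) <| .cons .s alfredAfterC5 .nil .nil) .nil) .nil))

/-- A certificate for Alfred with the ball at n15 and 9 diagonal chaps. -/
def alfredDownD5 : Cert :=
  .place 4 5 (.mk (.finish [.sw, .n, .n, .n]) (.cons 3 4 .loop <| .cons 3 6 (.finish [.sw, .n,
  .n]) <| .cons 3 8 (.finish [.sw, .n, .n]) .nil) (.cons .sw (.finish [.n, .n, .n]) (.cons .n
  (.finish [.n, .n]) (.cons .e alfredAfterD6 .nil <| .cons .n (.finish [.n]) (.cons .n .won .nil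
  .nil) .nil) .nil) .nil))

/-- A certificate for Alfred with the ball at n15 and 11 diagonal chaps. -/
def alfredDownB3 : Cert :=
  .place 2 3 (.mk alfredAfterA2 (.cons 1 2 (.place 14 16 (.mk (.finish [.n]) .nil (.cons .n .won
  .nil .nil))) <| .cons 14 13 (.place 14 16 (.mk (.finish [.n]) .nil (.cons .n .won .nil <| .cons
  .sw (.place 2 3 (.mk (.finish [.ne, .n, .n, .n]) (.cons 3 4 (.place 4 5 (.mk (.finish [.ne, .w,
  .n, .n]) (.cons 3 6 (.finish [.ne, .w, .ne, .nw, .e, .ne, .ne, .nw, .nw, .nw]) <| .cons 5 6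
  (.place 6 7 (.mk (.finish [.ne, .nw, .n]) (.cons 7 8 (.place 8 9 (.mk (.finish [.ne, .nw, .n])
  (.cons 9 10 (.place 10 11 (.mk (.finish [.ne, .nw, .n]) (.cons 11 12 (.place 12 13 (.mk
  (.finish [.ne, .nw, .ne, .ne]) (.cons 13 14 (.jump [.ne] (.mk (.finish [.n]) .nil (.cons .n
  .won .nil .nil))) <| .cons 11 16 (.finish [.ne, .nw, .nw]) <| .cons 13 18 (.finish [.ne, .nw,
  .ne]) .nil) (.cons .ne (.finish [.nw, .ne, .ne]) (.cons .nw (.finish [.ne, .ne]) (.cons .e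
  (.finish [.nw, .ne]) (.cons .nw (.finish [.ne]) (.cons .e (.finish [.ne]) (.cons .ne .won .nil
  <| .cons .nw .won .nil .nil) <| .cons .ne .won .nil .nil) .nil) <| .cons .ne (.finish [.ne])
  (.cons .ne .won .nil <| .cons .nw .won .nil <| .cons .w (.finish [.ne]) (.cons .ne .won .nil
  .nil) .nil) .nil) .nil) .nil))) <| .cons 9 14 (.finish [.ne, .nw, .ne, .nw]) .nil) (.cons .ne
  (.finish [.nw, .n]) (.cons .e alfredAfterM13 .nil <| .cons .nw (.finish [.n]) (.cons .n .won
  .nil .nil) <| .cons .s alfredAfterJ10 (.cons .e alfredAfterL11 .nil .nil) .nil) .nil))) <|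
  .cons 7 12 (.finish [.ne, .nw, .ne, .ne, .nw]) .nil) (.cons .ne (.finish [.nw, .n]) (.cons .nw
  (.finish [.n]) (.cons .n .won .nil .nil) .nil) .nil))) <| .cons 5 10 (.finish [.ne, .nw, .ne,
  .nw, .nw, .ne]) .nil) (.cons .ne (.finish [.nw, .n]) (.cons .nw (.finish [.n]) (.cons .n .won
  .nil .nil) .nil) .nil))) <| .cons 3 8 (.finish [.ne, .w, .n]) .nil) (.cons .ne (.finish [.w,
  .n, .n]) (.cons .w (.finish [.n, .n]) (.cons .n (.finish [.n]) (.cons .n .won .nil .nil) <|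
  .cons .s alfredAfterC5 .nil .nil) .nil) .nil))) <| .cons 3 6 (.finish [.ne, .n, .n]) <| .cons 3
  8 (.finish [.ne, .n, .n]) .nil) (.cons .ne (.finish [.n, .n, .n]) (.cons .n (.finish [.n, .n])
  (.cons .e alfredAfterD6 .nil <| .cons .n (.finish [.n]) (.cons .n .won .nil .nil) .nil) .nil)
  .nil))) .nil .nil))) <| .cons 14 14 (.finish [.s, .nw, .ne, .ne]) <| .cons 11 15 (.place 1 2
  (.mk (.place 14 16 (.mk (.finish [.n]) .nil (.cons .n .won .nil .nil))) (.cons 14 14 (.finish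
  [.s, .nw, .ne, .ne]) <| .cons 13 15 (.finish [.w, .nw, .ne]) <| .cons 13 16 (.finish [.nw,
  .ne]) <| .cons 14 16 (.finish [.n]) .nil) .nil)) <| .cons 13 15 (.finish [.w, .ne, .nw]) <|
  .cons 11 16 (.place 1 2 (.mk (.place 14 16 (.mk (.finish [.n]) .nil (.cons .n .won .nil .nil)))
  (.cons 14 14 (.finish [.s, .nw, .nw]) <| .cons 13 15 (.finish [.w, .ne, .nw]) <| .cons 13 16
  (.finish [.nw, .ne]) <| .cons 14 16 (.finish [.n]) .nil) .nil)) <| .cons 13 16 (.finish [.nw,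
  .ne]) <| .cons 14 16 (.finish [.n]) <| .cons 13 17 (.place 14 16 (.mk (.finish [.n]) .nil
  (.cons .n .won .nil <| .cons .sw (.place 2 3 (.mk (.finish [.ne, .n, .n, .n]) (.cons 3 4
  (.place 4 5 (.mk (.finish [.ne, .w, .n, .n]) (.cons 3 6 (.finish [.ne, .w, .ne, .nw, .e, .ne,
  .ne, .nw, .nw, .nw]) <| .cons 5 6 (.place 6 7 (.mk (.finish [.ne, .nw, .n]) (.cons 7 8 (.place
  8 9 (.mk (.finish [.ne, .nw, .n]) (.cons 9 10 (.place 10 11 (.mk (.finish [.ne, .nw, .n])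
  (.cons 11 12 (.place 12 13 (.mk (.finish [.ne, .nw, .ne, .ne]) (.cons 13 14 (.jump [.ne] (.mk
  (.finish [.n]) .nil (.cons .n .won .nil .nil))) <| .cons 11 16 (.finish [.ne, .nw, .nw]) <|
  .cons 13 18 (.finish [.ne, .nw, .ne]) .nil) (.cons .ne (.finish [.nw, .ne, .ne]) (.cons .nw
  (.finish [.ne, .ne]) (.cons .e (.finish [.n, .ne]) (.cons .n (.finish [.ne]) (.cons .ne .won
  .nil <| .cons .nw .won .nil <| .cons .w (.finish [.ne]) (.cons .ne .won .nil <| .cons .se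
  (.place 12 17 (.mk (.finish [.nw, .ne]) (.cons 11 18 (.finish [.nw]) .nil) (.cons .nw (.finish
  [.ne]) (.cons .ne .won .nil .nil) .nil))) .nil .nil) <| .cons .sw alfredAfterK17 .nil .nil) <|
  .cons .nw (.finish [.ne]) (.cons .e (.finish [.ne]) (.cons .ne .won .nil <| .cons .nw .won .nil
  <| .cons .s (.place 12 17 (.mk (.finish [.nw, .ne]) (.cons 11 18 (.finish [.nw]) .nil) (.cons
  .nw (.finish [.ne]) (.cons .ne .won .nil .nil) .nil))) .nil .nil) <| .cons .ne .won .nil .nil)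
  .nil) <| .cons .ne (.finish [.ne]) (.cons .ne .won .nil <| .cons .nw .won .nil <| .cons .w
  (.finish [.ne]) (.cons .ne .won .nil .nil) <| .cons .s (.place 11 17 (.mk (.finish [.w, .n,
  .ne]) (.cons 11 16 (.finish [.w, .ne]) <| .cons 11 18 (.finish [.w, .n]) .nil) (.cons .w
  (.finish [.n, .ne]) (.cons .n (.finish [.ne]) (.cons .e (.finish [.ne]) (.cons .ne .won .nil <|
  .cons .nw .won .nil .nil) <| .cons .ne .won .nil .nil) .nil) .nil))) (.cons .w alfredAfterK17
  .nil .nil) .nil) .nil) .nil) .nil))) <| .cons 9 14 (.finish [.ne, .nw, .ne, .nw]) .nil) (.cons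
  .ne (.finish [.nw, .n]) (.cons .e (.place 13 11 (.mk (.finish [.s, .w, .n, .nw, .n]) (.cons 11
  10 (.place 10 10 (.mk (.finish [.s, .w, .nw, .n]) (.cons 9 10 (.finish [.s, .w, .n, .nw, .ne,
  .ne, .nw]) <| .cons 13 10 (.finish [.s, .nw, .n, .nw, .ne, .nw]) <| .cons 7 12 (.finish [.s,
  .w, .nw, .nw, .ne, .ne]) .nil) (.cons .s (.finish [.w, .nw, .n]) (.cons .w (.finish [.nw, .n])
  (.cons .nw (.finish [.n]) (.cons .n .won .nil .nil) .nil) .nil) .nil))) <| .cons 13 10 (.finish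
  [.s, .nw, .n, .nw, .ne, .nw]) <| .cons 11 12 (.place 9 14 (.mk (.finish [.s, .w, .n, .w, .n])
  (.cons 11 10 (.finish [.s, .w, .ne, .w, .n, .nw, .nw, .ne]) <| .cons 13 10 (.finish [.s, .nw,
  .n, .nw, .ne, .nw]) <| .cons 9 13 (.finish [.s, .w, .n, .w, .ne, .nw, .ne]) <| .cons 11 13
  (.finish [.s, .w, .n, .ne, .n, .ne]) .nil) (.cons .s (.finish [.w, .n, .w, .n]) (.cons .w
  (.finish [.n, .w, .n]) (.cons .n (.finish [.w, .n]) (.cons .w (.finish [.n]) (.cons .n .won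
  .nil .nil) .nil) .nil) .nil) .nil))) <| .cons 9 14 (.finish [.s, .w, .n, .nw, .ne, .nw]) .nil)
  (.cons .s (.finish [.w, .n, .nw, .n]) (.cons .w (.finish [.n, .nw, .n]) (.cons .n (.finish
  [.nw, .n]) (.cons .nw (.finish [.n]) (.cons .n .won .nil .nil) .nil) .nil) .nil) .nil))) .nil
  <| .cons .nw (.finish [.n]) (.cons .n .won .nil .nil) <| .cons .s alfredAfterJ10 (.cons .e
  alfredAfterL11 .nil .nil) .nil) .nil))) <| .cons 7 12 (.finish [.ne, .nw, .ne, .ne, .nw]) .nil)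
  (.cons .ne (.finish [.nw, .n]) (.cons .nw (.finish [.n]) (.cons .n .won .nil .nil) .nil)
  .nil))) <| .cons 5 10 (.finish [.ne, .nw, .ne, .nw, .nw, .ne]) .nil) (.cons .ne (.finish [.nw,
  .n]) (.cons .nw (.finish [.n]) (.cons .n .won .nil .nil) .nil) .nil))) <| .cons 3 8 (.finish
  [.ne, .w, .n]) .nil) (.cons .ne (.finish [.w, .n, .n]) (.cons .w (.finish [.n, .n]) (.cons .n
  (.finish [.n]) (.cons .n .won .nil .nil) <| .cons .s alfredAfterC5 .nil .nil) .nil) .nil))) <|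
  .cons 3 6 (.finish [.ne, .n, .n]) <| .cons 3 8 (.finish [.ne, .n, .n]) .nil) (.cons .ne
  (.finish [.n, .n, .n]) (.cons .n (.finish [.n, .n]) (.cons .e alfredAfterD6 .nil <| .cons .n
  (.finish [.n]) (.cons .n .won .nil .nil) .nil) .nil) .nil))) .nil .nil))) <| .cons 11 18
  (.place 1 2 (.mk (.place 14 16 (.mk (.finish [.n]) .nil (.cons .n .won .nil .nil))) (.cons 14
  14 (.finish [.s, .nw, .ne, .ne]) <| .cons 13 15 (.finish [.w, .ne, .nw]) <| .cons 13 16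
  (.finish [.nw]) <| .cons 14 16 (.finish [.n]) .nil) .nil)) <| .cons 13 18 (.place 1 2 (.mk
  (.place 14 16 (.mk (.finish [.n]) .nil (.cons .n .won .nil .nil))) (.cons 14 14 (.finish [.s,
  .nw, .ne]) <| .cons 13 15 (.finish [.w, .ne, .n]) <| .cons 13 16 (.finish [.nw, .ne]) <| .cons
  14 16 (.finish [.n]) .nil) .nil)) <| .cons 11 19 alfredAfterA2 .nil) (.cons .sw .loop .nil
  .nil))

/-- A certificate for Betty with the ball at a2 and 1 diagonal chaps. -/
def bettyUpC4 : Cert :=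
  .place 3 4 (.mk (.finish [.ne, .se, .s]) (.cons 6 3 (.finish [.ne, .se, .sw]) <| .cons 4 5
  .loop .nil) (.cons .ne (.finish [.se, .s]) (.cons .n bettyAfterE7 (.cons .w bettyAfterC6 .nil
  .nil) <| .cons .w bettyAfterB4 .nil <| .cons .se (.finish [.s]) (.cons .s .won .nil .nil) .nil)
  .nil))

/-- A certificate for Betty with the ball at a2 and 3 diagonal chaps. -/
def bettyUpE6 : Cert :=
  .place 5 6 (.mk (.finish [.ne, .se, .s]) (.cons 8 5 (.finish [.ne, .se, .sw, .sw]) <| .cons 6 7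
  .loop .nil) (.cons .ne (.finish [.se, .s]) (.cons .se (.finish [.s]) (.cons .s .won .nil .nil)
  .nil) .nil))

/-- A certificate for Betty with the ball at a2 and 5 diagonal chaps. -/
def bettyUpG8 : Cert :=
  .place 7 8 (.mk (.finish [.ne, .se, .s]) (.cons 10 7 (.finish [.ne, .se, .se, .sw, .se]) <|
  .cons 8 9 .loop .nil) (.cons .ne (.finish [.se, .s]) (.cons .se (.finish [.s]) (.cons .s .won
  .nil .nil) .nil) .nil))

/-- A certificate for Betty with the ball at a2 and 7 diagonal chaps. -/
def bettyUpI10 : Cert :=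
  .place 9 10 (.mk (.finish [.ne, .e, .s, .s]) (.cons 12 9 (.finish [.ne, .e, .s]) <| .cons 10 11
  .loop <| .cons 12 11 (.finish [.ne, .e, .sw, .se, .sw, .sw, .sw]) .nil) (.cons .ne (.finish
  [.e, .s, .s]) (.cons .e (.finish [.s, .s]) (.cons .n bettyAfterL12 .nil <| .cons .s (.finish
  [.s]) (.cons .s .won .nil .nil) .nil) .nil) .nil))

/-- A certificate for Betty with the ball at a2 and 9 diagonal chaps. -/
def bettyUpK12 : Cert :=
  .place 11 12 (.mk (.finish [.ne, .s, .s, .s]) (.cons 12 9 (.finish [.ne, .s, .s]) <| .cons 12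
  11 (.finish [.ne, .s, .s]) <| .cons 12 13 .loop .nil) (.cons .ne (.finish [.s, .s, .s]) (.cons
  .s (.finish [.s, .s]) (.cons .w bettyAfterK11 .nil <| .cons .s (.finish [.s]) (.cons .s .won
  .nil .nil) .nil) .nil) .nil))

/-- A certificate for Betty with the ball at a2 and 11 diagonal chaps. -/
def bettyUpM14 : Cert :=
  .place 13 14 (.mk bettyAfterN15 (.cons 1 1 (.finish [.s]) <| .cons 2 1 (.finish [.se]) <| .cons
  4 1 bettyAfterN15 <| .cons 2 2 (.finish [.e, .sw]) <| .cons 4 2 (.place 14 15 (.mk (.place 1 1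
  (.mk (.finish [.s]) .nil (.cons .s .won .nil .nil))) (.cons 1 1 (.finish [.s]) <| .cons 2 1
  (.finish [.se]) <| .cons 2 2 (.finish [.e, .se]) <| .cons 1 3 (.finish [.n, .se]) .nil) .nil))
  <| .cons 1 3 (.finish [.n, .se]) <| .cons 1 4 (.place 1 1 (.mk (.finish [.s]) .nil (.cons .ne
  (.place 13 14 (.mk (.finish [.sw, .s, .s, .s]) (.cons 12 9 (.finish [.sw, .s, .s]) <| .cons 12
  11 (.finish [.sw, .s, .s]) <| .cons 12 13 (.place 11 12 (.mk (.finish [.sw, .e, .s, .s]) (.cons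
  12 9 (.finish [.sw, .e, .s]) <| .cons 10 11 (.place 9 10 (.mk (.finish [.sw, .se, .s]) (.cons
  10 7 (.finish [.sw, .se, .se, .sw, .se]) <| .cons 8 9 (.place 7 8 (.mk (.finish [.sw, .se, .s])
  (.cons 8 5 (.finish [.sw, .se, .sw, .sw]) <| .cons 6 7 (.place 5 6 (.mk (.finish [.sw, .se,
  .s]) (.cons 6 3 (.finish [.sw, .se, .sw]) <| .cons 4 5 (.place 3 4 (.mk (.finish [.sw, .se])
  (.cons 4 1 (.finish [.sw, .se]) <| .cons 2 3 (.jump [.sw] (.mk (.finish [.s]) .nil (.cons .s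
  .won .nil .nil))) .nil) (.cons .sw (.finish [.se]) (.cons .se .won (.cons .w .won .nil .nil)
  .nil) .nil))) .nil) (.cons .sw (.finish [.se, .s]) (.cons .n bettyAfterE7 (.cons .w
  bettyAfterC6 .nil .nil) <| .cons .w bettyAfterB4 .nil <| .cons .se (.finish [.s]) (.cons .s
  .won .nil .nil) .nil) .nil))) .nil) (.cons .sw (.finish [.se, .s]) (.cons .se (.finish [.s])
  (.cons .s .won .nil .nil) .nil) .nil))) .nil) (.cons .sw (.finish [.se, .s]) (.cons .se
  (.finish [.s]) (.cons .s .won .nil .nil) .nil) .nil))) <| .cons 12 11 (.finish [.sw, .e, .sw,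
  .se, .sw, .sw, .sw]) .nil) (.cons .sw (.finish [.e, .s, .s]) (.cons .e (.finish [.s, .s])
  (.cons .n bettyAfterL12 .nil <| .cons .s (.finish [.s]) (.cons .s .won .nil .nil) .nil) .nil)
  .nil))) .nil) (.cons .sw (.finish [.s, .s, .s]) (.cons .s (.finish [.s, .s]) (.cons .w
  bettyAfterK11 .nil <| .cons .s (.finish [.s]) (.cons .s .won .nil .nil) .nil) .nil) .nil)))
  .nil <| .cons .s .won .nil .nil))) <| .cons 14 15 (.place 1 1 (.mk (.finish [.s]) .nil (.cons
  .s .won .nil .nil))) .nil) (.cons .ne .loop .nil .nil))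

/-- A certificate for Betty with the ball at n15 and 0 diagonal chaps. -/
def bettyDownM14 : Cert :=
  .place 13 14 (.mk (.finish [.sw, .s, .s, .s]) (.cons 12 9 (.finish [.sw, .s, .s]) <| .cons 12
  11 (.finish [.sw, .s, .s]) <| .cons 12 13 .loop .nil) (.cons .sw (.finish [.s, .s, .s]) (.cons
  .s (.finish [.s, .s]) (.cons .w bettyAfterK11 .nil <| .cons .s (.finish [.s]) (.cons .s .won
  .nil .nil) .nil) .nil) .nil))

/-- A certificate for Betty with the ball at n15 and 2 diagonal chaps. -/
def bettyDownK12 : Cert :=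
  .place 11 12 (.mk (.finish [.sw, .e, .s, .s]) (.cons 12 9 (.finish [.sw, .e, .s]) <| .cons 10
  11 .loop <| .cons 12 11 (.finish [.sw, .e, .sw, .se, .sw, .sw, .sw]) .nil) (.cons .sw (.finish
  [.e, .s, .s]) (.cons .e (.finish [.s, .s]) (.cons .n bettyAfterL12 .nil <| .cons .s (.finish
  [.s]) (.cons .s .won .nil .nil) .nil) .nil) .nil))

/-- A certificate for Betty with the ball at n15 and 4 diagonal chaps. -/
def bettyDownI10 : Cert :=
  .place 9 10 (.mk (.finish [.sw, .se, .s]) (.cons 10 7 (.finish [.sw, .se, .se, .sw, .se]) <|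
  .cons 8 9 .loop .nil) (.cons .sw (.finish [.se, .s]) (.cons .se (.finish [.s]) (.cons .s .won
  .nil .nil) .nil) .nil))

/-- A certificate for Betty with the ball at n15 and 6 diagonal chaps. -/
def bettyDownG8 : Cert :=
  .place 7 8 (.mk (.finish [.sw, .se, .s]) (.cons 8 5 (.finish [.sw, .se, .sw, .sw]) <| .cons 6 7
  .loop .nil) (.cons .sw (.finish [.se, .s]) (.cons .se (.finish [.s]) (.cons .s .won .nil .nil)
  .nil) .nil))

/-- A certificate for Betty with the ball at n15 and 8 diagonal chaps. -/
def bettyDownE6 : Cert :=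
  .place 5 6 (.mk (.finish [.sw, .se, .s]) (.cons 6 3 (.finish [.sw, .se, .sw]) <| .cons 4 5
  .loop .nil) (.cons .sw (.finish [.se, .s]) (.cons .n bettyAfterE7 (.cons .w bettyAfterC6 .nil
  .nil) <| .cons .w bettyAfterB4 .nil <| .cons .se (.finish [.s]) (.cons .s .won .nil .nil) .nil)
  .nil))

/-- A certificate for Betty with the ball at n15 and 10 diagonal chaps. -/
def bettyDownC4 : Cert :=
  .place 3 4 (.mk (.finish [.sw, .se]) (.cons 4 1 (.finish [.sw, .se]) <| .cons 2 3 .loop .nil)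
  (.cons .sw (.finish [.se]) (.cons .se .won (.cons .w .won .nil .nil) .nil) .nil))

/-- A certificate for Betty with Alfred to move at `R0`. -/
def bettyAtR0 : Reply :=
  .mk (.place 1 1 (.mk (.finish [.s]) .nil (.cons .s .won .nil .nil))) (.cons 1 1
  (.finish [.s]) <| .cons 2 1 (.finish [.se]) <| .cons 2 2 (.finish [.e, .sw]) <| .cons 1 3
  (.place 1 1 (.mk (.finish [.s]) .nil (.cons .n (.place 2 3 (.mk (.finish [.se]) (.cons 4 1
  (.finish [.se]) .nil) (.cons .se .won (.cons .w .won .nil .nil) .nil))) .nil <| .cons .s .won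
  .nil .nil))) <| .cons 2 3 .loop .nil) .nil

/-- A certificate for Betty with the ball at n15 and 12 diagonal chaps. -/
def bettyDownJump : Cert := .jump [.sw] bettyAtR0

/-- Alfred's positions of the cycle, with certificates. -/
def alfredCycle : List (ℕ × ℕ × Cert) :=
  [(33, first 0, alfredUpB3),
   (33, first 2, alfredUpD5),
   (33, first 4, alfredUpF7),
   (33, first 6, alfredUpH9),
   (33, first 8, alfredUpJ11),
   (33, first 10, alfredUpL13),
   (33, first 12, alfredUpJump),
   (254, last 1, alfredDownL13),
   (254, last 3, alfredDownJ11),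
   (254, last 5, alfredDownH9),
   (254, last 7, alfredDownF7),
   (254, last 9, alfredDownD5),
   (254, last 11, alfredDownB3)]

/-- Betty's positions of the cycle, with certificates. -/
def bettyCycle : List (ℕ × ℕ × Cert) :=
  [(33, first 1, bettyUpC4),
   (33, first 3, bettyUpE6),
   (33, first 5, bettyUpG8),
   (33, first 7, bettyUpI10),
   (33, first 9, bettyUpK12),
   (33, first 11, bettyUpM14),
   (254, last 0, bettyDownM14),
   (254, last 2, bettyDownK12),
   (254, last 4, bettyDownI10),
   (254, last 6, bettyDownG8),
   (254, last 8, bettyDownE6),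
   (254, last 10, bettyDownC4),
   (254, last 12, bettyDownJump)]

/-- The ball codes and bitboards of a list of positions with certificates. -/
def positions (l : List (ℕ × ℕ × Cert)) : List (ℕ × ℕ) := l.map fun i => (i.1, i.2.1)

/-- All certificates in the list are correct and start with a move. -/
def Checks (P : Player) (l : List (ℕ × ℕ × Cert)) : Prop :=
  ∀ i ∈ l, i.2.2.isMove = true ∧ (i.2.2.check P (positions l) i.1 i.2.1).isSome = true

theorem alfredCycle_checks : Checks true alfredCycle := by
  unfold Checks
  decide +kernel

theorem bettyCycle_checks : Checks false bettyCycle := by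
  unfold Checks
  decide +kernel

theorem Checks.drawsFrom {P : Player} {l : List (ℕ × ℕ × Cert)} (hl : Checks P l) {s : PState}
    (hs : Forced P (InList P (positions l)) s) : DrawsFrom 19 15 P s := by
  refine hs.drawsFrom ?_
  rintro _ ⟨i, hi, rfl⟩
  obtain ⟨j, hj, rfl⟩ := List.mem_map.1 hi
  obtain ⟨hmove, hsome⟩ := hl j hj
  obtain ⟨z, hz⟩ := Option.isSome_iff_exists.1 hsome
  obtain ⟨hw, ht⟩ := (j.2.2.check_sound hz (agrees_pointsOf j.2.1 z)).2 hmove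
  exact ⟨hw, rfl, ht⟩

theorem R0_eq : R0 = ⟨pt 33, pointsOf chapsR0, true⟩ := by
  have hchaps : R0chaps = pointsOf chapsR0 := by
    unfold R0chaps pointsOf
    decide +kernel
  rw [R0, hchaps]
  rfl

theorem bettyAtR0_check :
    (bettyAtR0.check false (positions bettyCycle) 33 chapsR0).isSome = true := by
  decide +kernel

/-- **Theorem.**  The position `R0` on the official 19 × 15 Phutball pitch
(with Alfred to move) is drawn: both Alfred and Betty have drawing strategies
from `R0`. -/
theorem R0_drawn : Drawn 19 15 R0 := by
  constructor
  · exact alfredCycle_checks.drawsFrom (.base ⟨(33, first 0), by simp [positions, alfredCycle],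
      R0_eq⟩)
  · obtain ⟨z, hz⟩ := Option.isSome_iff_exists.1 bettyAtR0_check
    refine bettyCycle_checks.drawsFrom ?_
    rw [R0_eq]
    exact bettyAtR0.check_sound hz (agrees_pointsOf _ _)
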